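/- Consider a Barabanov linear switched system with data A, b, c. Then Condition G holds: for all nonzero x₀, l₀ ∈ ℝ³, if for i = 1, 2 the pair (xᵢ, lᵢ) consists of locally absolutely continuous functions satisfying, for some measurable uᵢ : [0,∞) → [0,1], xᵢ'(t) = A xᵢ(t) + uᵢ(t)·b·(cᵀxᵢ(t)) and lᵢ'(t) = −Aᵀlᵢ(t) − uᵢ(t)·c·(bᵀlᵢ(t)) for a.e. t ≥ 0, with (xᵢ(0), lᵢ(0)) = (x₀, l₀) and uᵢ(t)·(bᵀlᵢ(t))·(cᵀxᵢ(t)) = max_{w ∈ [0,1]} w·(bᵀlᵢ(t))·(cᵀxᵢ(t)) for a.e. t ≥ 0, then (x₁, l₁) = (x₂, l₂) on [0,∞). -/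

import Mathlib

open MeasureTheory Filter Topology RealInnerProductSpace Matrix

noncomputable section

abbrev Vec3 := EuclideanSpace ℝ (Fin 3)

def mulE (A : Matrix (Fin 3) (Fin 3) ℝ) (y : Vec3) : Vec3 :=
  Matrix.toEuclideanLin A y

/-- A real matrix is Hurwitz if all its complex eigenvalues have negative real part. -/
def IsHurwitz (A : Matrix (Fin 3) (Fin 3) ℝ) : Prop :=
  ∀ μ : ℂ, (A.map (fun r => (r : ℂ))).charpoly.IsRoot μ → μ.re < 0

/-- The rank-one matrix `b cᵀ`. -/
def bcMat (b c : Vec3) : Matrix (Fin 3) (Fin 3) ℝ :=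
  Matrix.vecMulVec (fun i => b i) (fun i => c i)

/-- `x` is a solution of the Barabanov linear switched system
`x' = A x + u(t) b (cᵀ x)` with switching signal `u`. -/
def IsBSolWith (A : Matrix (Fin 3) (Fin 3) ℝ) (b c : Vec3) (u : ℝ → ℝ)
    (x : ℝ → Vec3) : Prop :=
  Measurable u ∧ (∀ t, u t ∈ Set.Icc (0:ℝ) 1) ∧ ContinuousOn x (Set.Ici 0) ∧
    ∀ t ≥ (0:ℝ), x t = x 0 + ∫ s in (0:ℝ)..t, (mulE A (x s) + (u s * ⟪c, x s⟫) • b)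

/-- `l` is a solution of the adjoint system `l' = -Aᵀ l - u(t) c (bᵀ l)`. -/
def IsBAdjWith (A : Matrix (Fin 3) (Fin 3) ℝ) (b c : Vec3) (u : ℝ → ℝ)
    (l : ℝ → Vec3) : Prop :=
  ContinuousOn l (Set.Ici 0) ∧
    ∀ t ≥ (0:ℝ), l t = l 0 - ∫ s in (0:ℝ)..t, (mulE (Aᵀ) (l s) + (u s * ⟪b, l s⟫) • c)

/-- The data `(A, b, c)` defines a Barabanov linear switched system:
`A` and `A + b cᵀ` are Hurwitz, the pairs `(A, b)` and `(Aᵀ, c)` are controllable and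
the largest Lyapunov exponent of the system is zero. -/
def IsBarabanovData (A : Matrix (Fin 3) (Fin 3) ℝ) (b c : Vec3) : Prop :=
  IsHurwitz A ∧ IsHurwitz (A + bcMat b c) ∧
    LinearIndependent ℝ ![b, mulE A b, mulE A (mulE A b)] ∧
    LinearIndependent ℝ ![c, mulE (Aᵀ) c, mulE (Aᵀ) (mulE (Aᵀ) c)] ∧
    sSup {r : EReal | ∃ u x, IsBSolWith A b c u x ∧ x 0 ≠ 0 ∧
        r = limsup (fun t => ((Real.log ‖x t‖ / t : ℝ) : EReal)) atTop} = 0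

def IsBNorm (v : Vec3 → ℝ) : Prop :=
  (∀ x, v x = 0 ↔ x = 0) ∧ (∀ (a : ℝ) (x : Vec3), v (a • x) = |a| * v x) ∧
    ∀ x y, v (x + y) ≤ v x + v y

/-- A Barabanov norm for the Barabanov linear switched system. -/
def IsBBarabanov (A : Matrix (Fin 3) (Fin 3) ℝ) (b c : Vec3) (v : Vec3 → ℝ) : Prop :=
  IsBNorm v ∧
    (∀ u x, IsBSolWith A b c u x → ∀ t ≥ (0:ℝ), v (x t) ≤ v (x 0)) ∧
    ∀ y : Vec3, ∃ u x, IsBSolWith A b c u x ∧ x 0 = y ∧ ∀ t ≥ (0:ℝ), v (x t) = v y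

def subdiff3 (v : Vec3 → ℝ) (x : Vec3) : Set Vec3 :=
  {l | ⟪l, x⟫ = v x ∧ ∀ y, ⟪l, y⟫ ≤ v y}

/-- The right-hand side `A y + u (cᵀ y) b` of the switched system, for a fixed control value. -/
def switchedField (A : Matrix (Fin 3) (Fin 3) ℝ) (b c : Vec3) (u : ℝ) (y : Vec3) : Vec3 :=
  mulE A y + (u * ⟪c, y⟫) • b

lemma continuous_mulE (A : Matrix (Fin 3) (Fin 3) ℝ) : Continuous (mulE A) :=
  (Matrix.toEuclideanLin A).continuous_of_finiteDimensional

lemma mulE_neg (A : Matrix (Fin 3) (Fin 3) ℝ) (y : Vec3) : mulE (-A) y = -mulE A y := by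
  simp [mulE]

lemma mulE_apply_neg (A : Matrix (Fin 3) (Fin 3) ℝ) (y : Vec3) : mulE A (-y) = -mulE A y := by
  simp [mulE]

lemma inner_mulE (A : Matrix (Fin 3) (Fin 3) ℝ) (d y : Vec3) :
    ⟪d, mulE A y⟫ = ⟪mulE Aᵀ d, y⟫ := by
  simp only [mulE, PiLp.inner_apply, Matrix.toLpLin_apply, Matrix.mulVec, dotProduct,
    Fin.sum_univ_three, Matrix.transpose_apply, RCLike.inner_apply, conj_trivial]
  ring

lemma switchedField_sub (A : Matrix (Fin 3) (Fin 3) ℝ) (b c : Vec3) (u : ℝ) (y z : Vec3) :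
    switchedField A b c u y - switchedField A b c u z = switchedField A b c u (y - z) := by
  have h : mulE A (y - z) = mulE A y - mulE A z := map_sub _ _ _
  simp only [switchedField, h, inner_sub_right, mul_sub, sub_smul]
  abel

lemma exists_switchedField_bound (A : Matrix (Fin 3) (Fin 3) ℝ) (b c : Vec3) :
    ∃ K : ℝ, 0 < K ∧ ∀ u ∈ Set.Icc (0:ℝ) 1, ∀ y, ‖switchedField A b c u y‖ ≤ K * ‖y‖ := by
  refine ⟨‖(Matrix.toEuclideanLin A).toContinuousLinearMap‖ + ‖c‖ * ‖b‖ + 1, by positivity, ?_⟩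
  intro u hu y
  have h1 : ‖mulE A y‖ ≤ ‖(Matrix.toEuclideanLin A).toContinuousLinearMap‖ * ‖y‖ :=
    (Matrix.toEuclideanLin A).toContinuousLinearMap.le_opNorm y
  have h2 : ‖(u * ⟪c, y⟫) • b‖ ≤ ‖c‖ * ‖y‖ * ‖b‖ := by
    rw [norm_smul, norm_mul]
    have h3 : ‖u‖ ≤ 1 := by rw [Real.norm_of_nonneg hu.1]; exact hu.2
    have h4 : ‖⟪c, y⟫‖ ≤ ‖c‖ * ‖y‖ := norm_inner_le_norm c y
    calc ‖u‖ * ‖⟪c, y⟫‖ * ‖b‖ ≤ 1 * (‖c‖ * ‖y‖) * ‖b‖ := by gcongr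
      _ = _ := by rw [one_mul]
  have h5 := norm_add_le (mulE A y) ((u * ⟪c, y⟫) • b)
  unfold switchedField
  nlinarith [norm_nonneg y]

section Solutions

variable {A : Matrix (Fin 3) (Fin 3) ℝ} {b c : Vec3} {u : ℝ → ℝ} {x : ℝ → Vec3}

lemma IsBSolWith.intervalIntegrable (h : IsBSolWith A b c u x) {s t : ℝ} (hs : 0 ≤ s)
    (ht : 0 ≤ t) :
    IntervalIntegrable (fun r => switchedField A b c (u r) (x r)) volume s t := by
  have hsub : Set.uIcc s t ⊆ Set.Ici 0 := fun r hr => (le_inf hs ht).trans hr.1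
  have hx : ContinuousOn x (Set.uIcc s t) := h.2.2.1.mono hsub
  have hu : IntervalIntegrable u volume s t := by
    refine (intervalIntegrable_const (c := (1:ℝ))).mono_fun h.1.aestronglyMeasurable ?_
    refine Eventually.of_forall fun r => ?_
    simp only [Real.norm_of_nonneg (h.2.1 r).1, norm_one]
    exact (h.2.1 r).2
  have h1 : IntervalIntegrable (fun r => mulE A (x r)) volume s t :=
    ((continuous_mulE A).comp_continuousOn hx).intervalIntegrable
  have h2 : IntervalIntegrable (fun r => u r * ⟪c, x r⟫) volume s t :=
    hu.mul_continuousOn (continuousOn_const.inner hx)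
  have h3 : IntervalIntegrable (fun r => (u r * ⟪c, x r⟫) • b) volume s t :=
    h2.smul_continuousOn continuousOn_const
  exact h1.add h3

lemma IsBSolWith.sub_eq (h : IsBSolWith A b c u x) {s t : ℝ} (hs : 0 ≤ s) (ht : 0 ≤ t) :
    x t - x s = ∫ r in s..t, switchedField A b c (u r) (x r) := by
  have h1 : x t = x 0 + ∫ r in (0:ℝ)..t, switchedField A b c (u r) (x r) := h.2.2.2 t ht
  have h2 : x s = x 0 + ∫ r in (0:ℝ)..s, switchedField A b c (u r) (x r) := h.2.2.2 s hs
  rw [h1, h2, ← intervalIntegral.integral_add_adjacent_intervals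
    (h.intervalIntegrable le_rfl hs) (h.intervalIntegrable hs ht)]
  abel

lemma IsBSolWith.shift (h : IsBSolWith A b c u x) {T : ℝ} (hT : 0 ≤ T) :
    IsBSolWith A b c (fun t => u (T + t)) (fun t => x (T + t)) := by
  refine ⟨h.1.comp (measurable_const_add T), fun t => h.2.1 _, ?_, fun t ht => ?_⟩
  · exact h.2.2.1.comp (by fun_prop) fun t ht => add_nonneg hT ht
  · have h1 := h.sub_eq hT (add_nonneg hT ht)
    have h2 := intervalIntegral.integral_comp_add_left (a := 0) (b := t)
      (fun r => switchedField A b c (u r) (x r)) T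
    rw [add_zero] at h2
    rw [← h2] at h1
    simp only [add_zero]
    exact sub_eq_iff_eq_add'.1 h1

lemma IsBAdjWith.isBSolWith {l : ℝ → Vec3} (hu : Measurable u)
    (hu' : ∀ t, u t ∈ Set.Icc (0:ℝ) 1) (h : IsBAdjWith A b c u l) :
    IsBSolWith (-Aᵀ) (-c) b u l := by
  refine ⟨hu, hu', h.1, fun t ht => ?_⟩
  rw [h.2 t ht, sub_eq_add_neg, ← intervalIntegral.integral_neg]
  simp only [mulE_neg, smul_neg, neg_add]

lemma IsBSolWith.inner_sub_eq (h : IsBSolWith A b c u x) (d : Vec3) {t : ℝ} (ht : 0 ≤ t) :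
    ⟪d, x t⟫ - ⟪d, x 0⟫ =
      ∫ r in (0:ℝ)..t, (⟪mulE Aᵀ d, x r⟫ + u r * ⟪d, b⟫ * ⟪c, x r⟫) := by
  rw [← inner_sub_right, h.sub_eq le_rfl ht]
  have h1 := (innerSL ℝ d).intervalIntegral_comp_comm (h.intervalIntegrable le_rfl ht)
  simp only [innerSL_apply_apply] at h1
  rw [← h1]
  refine intervalIntegral.integral_congr fun r _ => ?_
  simp only [switchedField, inner_add_right, inner_smul_right, inner_mulE]
  ring

end Solutions

/-- A continuous function on a compact interval that is dominated by a proper fraction of its own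
maximum vanishes. -/
lemma eq_zero_of_norm_le_mul_bound {a d q : ℝ} (hq : q < 1) {z : ℝ → Vec3}
    (hz : ContinuousOn z (Set.Icc a d))
    (h : ∀ M, (∀ s ∈ Set.Icc a d, ‖z s‖ ≤ M) → ∀ t ∈ Set.Icc a d, ‖z t‖ ≤ q * M) :
    ∀ t ∈ Set.Icc a d, z t = 0 := by
  intro t ht
  obtain ⟨m, hm, hmax⟩ := isCompact_Icc.exists_isMaxOn ⟨t, ht⟩ hz.norm
  have h1 := h ‖z m‖ (fun s hs => hmax hs) m hm
  have h2 : ‖z m‖ ≤ 0 := by nlinarith [norm_nonneg (z m)]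
  exact norm_le_zero_iff.1 ((hmax ht).trans h2)

lemma IsBSolWith.ne_zero {A : Matrix (Fin 3) (Fin 3) ℝ} {b c : Vec3} {u : ℝ → ℝ}
    {x : ℝ → Vec3} (h : IsBSolWith A b c u x) (h0 : x 0 ≠ 0) {T : ℝ} (hT : 0 ≤ T) :
    x T ≠ 0 := by
  intro hzero
  obtain ⟨K, hK, hbound⟩ := exists_switchedField_bound A b c
  have hcont : ContinuousOn (fun t => x (T - t)) (Set.Icc 0 T) :=
    h.2.2.1.comp (by fun_prop) fun t ht => sub_nonneg.2 ht.2
  have hclosed : IsClosed ({t | x (T - t) = 0} ∩ Set.Icc 0 T) := by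
    rw [Set.inter_comm]
    exact hcont.preimage_isClosed_of_isClosed isClosed_Icc (isClosed_singleton (x := (0 : Vec3)))
  have key : Set.Icc 0 T ⊆ {t | x (T - t) = 0} := by
    refine hclosed.Icc_subset_of_forall_exists_gt (by simpa using hzero) ?_
    rintro t ⟨ht0, ht⟩ y hy
    set d := min (min y T) (t + 1 / (2 * K)) with hd
    have htd : t < d := lt_min (lt_min hy ht.2) (lt_add_of_pos_right _ (by positivity))
    have hdT : d ≤ T := (min_le_left _ _).trans (min_le_right _ _)
    have hdK : K * (d - t) ≤ 1 / 2 := by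
      have : d - t ≤ 1 / (2 * K) := by linarith [min_le_right (min y T) (t + 1 / (2 * K))]
      calc K * (d - t) ≤ K * (1 / (2 * K)) := by gcongr
        _ = 1 / 2 := by field_simp
    refine ⟨d, ?_, htd, (min_le_left _ _).trans (min_le_left _ _)⟩
    refine eq_zero_of_norm_le_mul_bound (a := t) (d := d) (q := 1 / 2) (by norm_num)
      (hcont.mono (Set.Icc_subset_Icc ht.1 hdT)) ?_ d (Set.right_mem_Icc.2 htd.le)
    intro M hM s hs
    have hM0 : 0 ≤ M := (norm_nonneg _).trans (hM s hs)
    have h1 := h.sub_eq (s := T - t) (t := T - s) (by linarith [ht.2]) (by linarith [hs.2])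
    rw [show x (T - t) = 0 from ht0, sub_zero] at h1
    rw [h1]
    have h2 : ∀ r ∈ Set.uIoc (T - t) (T - s),
        ‖switchedField A b c (u r) (x r)‖ ≤ K * M := by
      intro r hr
      rw [Set.uIoc_of_ge (by linarith [hs.1])] at hr
      have h3 := hM (T - r) ⟨by linarith [hr.2], by linarith [hr.1, hs.2]⟩
      rw [sub_sub_cancel] at h3
      exact (hbound _ (h.2.1 r) _).trans (by gcongr)
    refine (intervalIntegral.norm_integral_le_of_norm_le_const h2).trans ?_
    have h4 : |T - s - (T - t)| ≤ d - t := by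
      rw [abs_le]; constructor <;> linarith [hs.1, hs.2]
    calc K * M * |T - s - (T - t)| ≤ K * M * (d - t) := by gcongr
      _ = K * (d - t) * M := by ring
      _ ≤ 1 / 2 * M := by gcongr
  exact h0 (by simpa using key (Set.right_mem_Icc.2 hT))

/-- Two solutions with the same initial value and almost everywhere equal controls on `(0, δ)`
agree on a right neighbourhood of `0`. -/
lemma exists_eqOn_of_control_ae_eq {A : Matrix (Fin 3) (Fin 3) ℝ} {b c : Vec3}
    {u₁ u₂ : ℝ → ℝ} {x₁ x₂ : ℝ → Vec3} (h₁ : IsBSolWith A b c u₁ x₁)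
    (h₂ : IsBSolWith A b c u₂ x₂) (h0 : x₁ 0 = x₂ 0) {δ : ℝ} (hδ : 0 < δ)
    (hu : ∀ᵐ t, t ∈ Set.Ioo 0 δ → u₁ t = u₂ t) :
    ∃ ε > 0, ∀ t ∈ Set.Icc 0 ε, x₁ t = x₂ t := by
  obtain ⟨K, hK, hbound⟩ := exists_switchedField_bound A b c
  set ε := min (δ / 2) (1 / (2 * K)) with hε
  have hε0 : 0 < ε := lt_min (by positivity) (by positivity)
  have hεδ : ε < δ := (min_le_left _ _).trans_lt (by linarith)
  have hεK : K * ε ≤ 1 / 2 := by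
    calc K * ε ≤ K * (1 / (2 * K)) := by gcongr; exact min_le_right _ _
      _ = 1 / 2 := by field_simp
  refine ⟨ε, hε0, fun t ht => sub_eq_zero.1 ?_⟩
  refine eq_zero_of_norm_le_mul_bound (z := fun t => x₁ t - x₂ t) (q := 1 / 2) (by norm_num)
    ((h₁.2.2.1.mono Set.Icc_subset_Ici_self).sub (h₂.2.2.1.mono Set.Icc_subset_Ici_self)) ?_ t ht
  intro M hM s hs
  have hM0 : 0 ≤ M := (norm_nonneg _).trans (hM s hs)
  have e : x₁ s - x₂ s = ∫ r in (0:ℝ)..s,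
      (switchedField A b c (u₁ r) (x₁ r) - switchedField A b c (u₂ r) (x₂ r)) := by
    rw [intervalIntegral.integral_sub (h₁.intervalIntegrable le_rfl hs.1)
      (h₂.intervalIntegrable le_rfl hs.1), ← h₁.sub_eq le_rfl hs.1, ← h₂.sub_eq le_rfl hs.1, h0]
    abel
  have hb : ∀ᵐ r, r ∈ Set.uIoc 0 s →
      ‖switchedField A b c (u₁ r) (x₁ r) - switchedField A b c (u₂ r) (x₂ r)‖ ≤ K * M := by
    filter_upwards [hu] with r hr hrs
    rw [Set.uIoc_of_le hs.1] at hrs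
    rw [← hr ⟨hrs.1, hrs.2.trans_lt (hs.2.trans_lt hεδ)⟩, switchedField_sub]
    exact (hbound _ (h₁.2.1 r) _).trans
      (mul_le_mul_of_nonneg_left (hM r ⟨hrs.1.le, hrs.2.trans hs.2⟩) hK.le)
  change ‖x₁ s - x₂ s‖ ≤ _
  rw [e]
  refine (intervalIntegral.norm_integral_le_of_norm_le_const_ae hb).trans ?_
  rw [sub_zero, abs_of_nonneg hs.1]
  calc K * M * s ≤ K * M * ε := by gcongr; exact hs.2
    _ = K * ε * M := by ring
    _ ≤ 1 / 2 * M := by gcongr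

/-- If `g s = α sⁱ + O(sⁱ⁺¹)` on `[0, 1]` then its primitive is `α / (i + 1) tⁱ⁺¹ + O(tⁱ⁺²)`. -/
lemma abs_integral_sub_pow_le {g : ℝ → ℝ} {α D : ℝ} {i : ℕ}
    (hg : ∀ t ∈ Set.Icc (0:ℝ) 1, IntervalIntegrable g volume 0 t) (hD : 0 ≤ D)
    (h : ∀ s ∈ Set.Icc (0:ℝ) 1, |g s - α * s ^ i| ≤ D * s ^ (i + 1)) :
    ∀ t ∈ Set.Icc (0:ℝ) 1,
      |(∫ s in (0:ℝ)..t, g s) - α / (i + 1) * t ^ (i + 1)| ≤ D * t ^ (i + 2) := by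
  intro t ht
  have e : (∫ s in (0:ℝ)..t, g s) - α / (i + 1) * t ^ (i + 1) =
      ∫ s in (0:ℝ)..t, (g s - α * s ^ i) := by
    rw [intervalIntegral.integral_sub (hg t ht)
      (Continuous.intervalIntegrable (by fun_prop) _ _), intervalIntegral.integral_const_mul,
      integral_pow]
    simp
    ring
  rw [e]
  have h1 : ∀ s ∈ Set.uIoc 0 t, ‖g s - α * s ^ i‖ ≤ D * t ^ (i + 1) := by
    intro s hs
    rw [Set.uIoc_of_le ht.1] at hs
    have := hs.1.le
    have h2 := hs.2
    exact (h s ⟨hs.1.le, hs.2.trans ht.2⟩).trans (by gcongr)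
  refine (intervalIntegral.norm_integral_le_of_norm_le_const h1).trans (le_of_eq ?_)
  rw [sub_zero, abs_of_nonneg ht.1]
  ring

lemma exists_pos_of_abs_sub_pow_le {y : ℝ → ℝ} {α C : ℝ} {i : ℕ} (hα : α ≠ 0)
    (h : ∀ t ∈ Set.Icc (0:ℝ) 1, |y t - α * t ^ i| ≤ C * t ^ (i + 1)) :
    ∃ δ > 0, ∀ t ∈ Set.Ioo 0 δ, 0 < α * y t := by
  have hα' : 0 < |α| := abs_pos.2 hα
  have hC : 0 < |C| + 1 := by positivity
  refine ⟨min 1 (|α| / (|C| + 1)), by positivity, fun t ht => ?_⟩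
  have h1 : t < 1 := ht.2.trans_le (min_le_left _ _)
  have h2 : t * (|C| + 1) < |α| := (lt_div_iff₀ hC).1 (ht.2.trans_le (min_le_right _ _))
  have h3 := h t ⟨ht.1.le, h1.le⟩
  have h4 : 0 < t ^ i := pow_pos ht.1 i
  have h5 : C * t < |α| := by nlinarith [le_abs_self C, ht.1]
  have h6 : |α * (y t - α * t ^ i)| < |α| * (|α| * t ^ i) := by
    rw [abs_mul]
    gcongr
    calc |y t - α * t ^ i| ≤ C * t * t ^ i := by rw [pow_succ] at h3; linarith
      _ < |α| * t ^ i := by gcongr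
  have h7 := (abs_lt.1 h6).1
  have h8 : |α| * (|α| * t ^ i) = α * α * t ^ i := by rw [← mul_assoc, abs_mul_abs_self]
  nlinarith

open Classical in
/-- The first nonvanishing number among `cᵀ z`, `cᵀ A z`, `cᵀ A² z` (up to a factor `1 / 2`, the
leading Taylor coefficient at time `0` of `cᵀ x` along any trajectory `x` starting at `z`). -/
def leadingCoeffOut (A : Matrix (Fin 3) (Fin 3) ℝ) (c z : Vec3) : ℝ :=
  if ⟪c, z⟫ ≠ 0 then ⟪c, z⟫
  else if ⟪mulE Aᵀ c, z⟫ ≠ 0 then ⟪mulE Aᵀ c, z⟫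
  else ⟪mulE Aᵀ (mulE Aᵀ c), z⟫

lemma leadingCoeffOut_ne_zero {A : Matrix (Fin 3) (Fin 3) ℝ} {c z : Vec3}
    (hobs : LinearIndependent ℝ ![c, mulE Aᵀ c, mulE Aᵀ (mulE Aᵀ c)]) (hz : z ≠ 0) :
    leadingCoeffOut A c z ≠ 0 := by
  unfold leadingCoeffOut
  split_ifs with h1 h2
  · exact h1
  · exact h2
  · intro h3
    push Not at h1 h2
    have hspan := hobs.span_eq_top_of_card_eq_finrank' (by simp)
    refine hz (inner_self_eq_zero (𝕜 := ℝ).1 ?_)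
    have hmem : z ∈ Submodule.span ℝ
        (Set.range ![c, mulE Aᵀ c, mulE Aᵀ (mulE Aᵀ c)]) := hspan ▸ Submodule.mem_top
    have hall : ∀ w ∈ Submodule.span ℝ
        (Set.range ![c, mulE Aᵀ c, mulE Aᵀ (mulE Aᵀ c)]), ⟪w, z⟫ = 0 := by
      intro w hw
      induction hw using Submodule.span_induction with
      | mem w hw =>
        obtain ⟨i, rfl⟩ := hw
        fin_cases i
        exacts [h1, h2, h3]
      | zero => simp
      | add v w _ _ hv hw => rw [inner_add_left, hv, hw, add_zero]
      | smul a w _ hw => rw [inner_smul_left, hw, mul_zero]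
    exact hall z hmem

/-- Near time `0`, the sign of `cᵀ x(t)` for `t > 0` depends on the initial value only, not on the
control. -/
lemma IsBSolWith.exists_pos {A : Matrix (Fin 3) (Fin 3) ℝ} {b c : Vec3} {u : ℝ → ℝ}
    {x : ℝ → Vec3} (h : IsBSolWith A b c u x) (hne : leadingCoeffOut A c (x 0) ≠ 0) :
    ∃ δ > 0, ∀ t ∈ Set.Ioo 0 δ, 0 < leadingCoeffOut A c (x 0) * ⟪c, x t⟫ := by
  obtain ⟨K, hK, hbound⟩ := exists_switchedField_bound A b c
  obtain ⟨B, hB⟩ := isCompact_Icc.exists_bound_of_continuousOn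
    (h.2.2.1.mono (Set.Icc_subset_Ici_self (a := (1:ℝ)) (b := 0)))
  have hB0 : 0 ≤ B := (norm_nonneg _).trans (hB 0 (by simp))
  have hlip : ∀ t ∈ Set.Icc (0:ℝ) 1, ‖x t - x 0‖ ≤ K * B * t := by
    intro t ht
    rw [h.sub_eq le_rfl ht.1]
    have h1 : ∀ r ∈ Set.uIoc 0 t, ‖switchedField A b c (u r) (x r)‖ ≤ K * B := by
      intro r hr
      rw [Set.uIoc_of_le ht.1] at hr
      exact (hbound _ (h.2.1 r) _).trans
        (mul_le_mul_of_nonneg_left (hB r ⟨hr.1.le, hr.2.trans ht.2⟩) hK.le)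
    simpa [abs_of_nonneg ht.1] using intervalIntegral.norm_integral_le_of_norm_le_const h1
  have hout : ∀ d : Vec3, ∃ C, 0 ≤ C ∧ ∀ t ∈ Set.Icc (0:ℝ) 1,
      |⟪d, x t⟫ - ⟪d, x 0⟫| ≤ C * t := by
    intro d
    refine ⟨‖d‖ * (K * B), by positivity, fun t ht => ?_⟩
    rw [← inner_sub_right]
    refine (abs_real_inner_le_norm _ _).trans ?_
    rw [mul_assoc]
    exact mul_le_mul_of_nonneg_left (hlip t ht) (norm_nonneg d)
  have hint : ∀ d : Vec3, ∀ t ∈ Set.Icc (0:ℝ) 1, IntervalIntegrable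
      (fun r => ⟪mulE Aᵀ d, x r⟫ + u r * ⟪d, b⟫ * ⟪c, x r⟫) volume 0 t := by
    intro d t ht
    have h1 := h.intervalIntegrable le_rfl ht.1
    have h2 : IntervalIntegrable (fun r => innerSL ℝ d (switchedField A b c (u r) (x r)))
        volume 0 t := ⟨(innerSL ℝ d).integrable_comp h1.1, (innerSL ℝ d).integrable_comp h1.2⟩
    refine h2.congr ?_
    refine fun r _ => ?_
    simp only [switchedField, innerSL_apply_apply, inner_add_right, inner_smul_right, inner_mulE]
    ring
  -- integrating an expansion of the derivative of `⟪d, x t⟫` when `⟪d, x 0⟫ = 0`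
  have hstep : ∀ (d : Vec3) (α C E : ℝ) (i : ℕ), ⟪d, x 0⟫ = 0 → 0 ≤ C → 0 ≤ E →
      (∀ t ∈ Set.Icc (0:ℝ) 1, |⟪mulE Aᵀ d, x t⟫ - α * t ^ i| ≤ C * t ^ (i + 1)) →
      (∀ t ∈ Set.Icc (0:ℝ) 1, |⟪c, x t⟫| ≤ E * t ^ (i + 1)) →
      ∃ D, 0 ≤ D ∧ ∀ t ∈ Set.Icc (0:ℝ) 1,
        |⟪d, x t⟫ - α / (i + 1) * t ^ (i + 1)| ≤ D * t ^ (i + 2) := by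
    intro d α C E i h0 hC hE h1 h2
    refine ⟨C + |⟪d, b⟫| * E, by positivity, fun t ht => ?_⟩
    have h3 := abs_integral_sub_pow_le (α := α) (D := C + |⟪d, b⟫| * E) (i := i) (hint d)
      (by positivity) (fun s hs => ?_) t ht
    · rwa [← h.inner_sub_eq d ht.1, h0, sub_zero] at h3
    · have h4 : |u s * ⟪d, b⟫ * ⟪c, x s⟫| ≤ |⟪d, b⟫| * (E * s ^ (i + 1)) := by
        rw [abs_mul, abs_mul, abs_of_nonneg (h.2.1 s).1]
        have := h2 s hs
        have := (h.2.1 s).2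
        have := (h.2.1 s).1
        gcongr
        exact mul_le_of_le_one_left (abs_nonneg _) (h.2.1 s).2
      have h5 : ⟪mulE Aᵀ d, x s⟫ + u s * ⟪d, b⟫ * ⟪c, x s⟫ - α * s ^ i =
          (⟪mulE Aᵀ d, x s⟫ - α * s ^ i) + u s * ⟪d, b⟫ * ⟪c, x s⟫ := by ring
      rw [h5]
      refine (abs_add_le _ _).trans ?_
      linarith [h1 s hs]
  obtain ⟨C₀, hC₀, h₀⟩ := hout c
  obtain ⟨C₁, hC₁, h₁⟩ := hout (mulE Aᵀ c)
  obtain ⟨C₂, hC₂, h₂⟩ := hout (mulE Aᵀ (mulE Aᵀ c))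
  unfold leadingCoeffOut at hne ⊢
  split_ifs at hne ⊢ with hc0 hc1
  · exact exists_pos_of_abs_sub_pow_le (i := 0) hne (C := C₀) (by simpa using h₀)
  · push Not at hc0
    simp only [hc0, sub_zero] at h₀
    obtain ⟨D, -, hD⟩ := hstep c ⟪mulE Aᵀ c, x 0⟫ C₁ C₀ 0 hc0 hC₁ hC₀ (by simpa using h₁)
      (by simpa using h₀)
    exact exists_pos_of_abs_sub_pow_le (i := 1) hne (C := D) (by simpa using hD)
  · push Not at hc0 hc1
    simp only [hc0, sub_zero] at h₀
    simp only [hc1, sub_zero] at h₁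
    obtain ⟨D, hD0, hD⟩ := hstep c 0 C₁ C₀ 0 hc0 hC₁ hC₀ (by simpa using h₁) (by simpa using h₀)
    simp only [zero_div, zero_mul, sub_zero, zero_add] at hD
    obtain ⟨D₁, hD₁0, hD₁⟩ := hstep (mulE Aᵀ c) _ C₂ C₀ 0 hc1 hC₂ hC₀ (by simpa using h₂)
      (by simpa using h₀)
    obtain ⟨D₂, -, hD₂⟩ := hstep c _ D₁ D 1 hc0 hD₁0 hD0 (by simpa using hD₁) (by simpa using hD)
    have hne2 := div_ne_zero hne (show ((1:ℕ) + 1 : ℝ) ≠ 0 by norm_num)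
    obtain ⟨δ, hδ, hpos⟩ := exists_pos_of_abs_sub_pow_le (i := 2) hne2 (by simpa using hD₂)
    refine ⟨δ, hδ, fun t ht => ?_⟩
    have := hpos t ht
    norm_num at this
    linarith

/-- A control value in `[0, 1]` maximizing `w ↦ w * φ` is determined by the sign of `φ ≠ 0`. -/
lemma control_eq_of_maximizing {v₁ v₂ φ₁ φ₂ κ : ℝ} (hv₁ : v₁ ∈ Set.Icc (0:ℝ) 1)
    (hv₂ : v₂ ∈ Set.Icc (0:ℝ) 1) (hφ₁ : 0 < κ * φ₁) (hφ₂ : 0 < κ * φ₂)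
    (h₁ : ∀ w ∈ Set.Icc (0:ℝ) 1, w * φ₁ ≤ v₁ * φ₁)
    (h₂ : ∀ w ∈ Set.Icc (0:ℝ) 1, w * φ₂ ≤ v₂ * φ₂) : v₁ = v₂ := by
  have a₁ := h₁ v₂ hv₂
  have a₂ := h₂ v₁ hv₁
  rcases pos_and_pos_or_neg_and_neg_of_mul_pos hφ₁ with ⟨hκ, p₁⟩ | ⟨hκ, p₁⟩ <;>
    rcases pos_and_pos_or_neg_and_neg_of_mul_pos hφ₂ with ⟨hκ', p₂⟩ | ⟨hκ', p₂⟩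
  · exact le_antisymm (le_of_mul_le_mul_right a₂ p₂) (le_of_mul_le_mul_right a₁ p₁)
  · exact absurd hκ hκ'.not_gt
  · exact absurd hκ' hκ.not_gt
  · exact le_antisymm ((mul_le_mul_right_of_neg p₁).1 a₁) ((mul_le_mul_right_of_neg p₂).1 a₂)

/-- Local uniqueness to the right of time `0` for extremal pairs. -/
lemma exists_eqOn_of_extremal {A : Matrix (Fin 3) (Fin 3) ℝ} {b c : Vec3}
    (hb : LinearIndependent ℝ ![b, mulE A b, mulE A (mulE A b)])
    (hc : LinearIndependent ℝ ![c, mulE Aᵀ c, mulE Aᵀ (mulE Aᵀ c)])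
    {u₁ u₂ : ℝ → ℝ} {x₁ x₂ l₁ l₂ : ℝ → Vec3}
    (hx₁ : IsBSolWith A b c u₁ x₁) (hx₂ : IsBSolWith A b c u₂ x₂)
    (hl₁ : IsBSolWith (-Aᵀ) (-c) b u₁ l₁) (hl₂ : IsBSolWith (-Aᵀ) (-c) b u₂ l₂)
    (hx : x₁ 0 = x₂ 0) (hl : l₁ 0 = l₂ 0) (hx0 : x₁ 0 ≠ 0) (hl0 : l₁ 0 ≠ 0)
    (hmax₁ : ∀ᵐ t, 0 ≤ t → ∀ w ∈ Set.Icc (0:ℝ) 1,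
        w * (⟪b, l₁ t⟫ * ⟪c, x₁ t⟫) ≤ u₁ t * (⟪b, l₁ t⟫ * ⟪c, x₁ t⟫))
    (hmax₂ : ∀ᵐ t, 0 ≤ t → ∀ w ∈ Set.Icc (0:ℝ) 1,
        w * (⟪b, l₂ t⟫ * ⟪c, x₂ t⟫) ≤ u₂ t * (⟪b, l₂ t⟫ * ⟪c, x₂ t⟫)) :
    ∃ ε > 0, ∀ t ∈ Set.Icc 0 ε, x₁ t = x₂ t ∧ l₁ t = l₂ t := by
  have hb' : LinearIndependent ℝ
      ![b, mulE (-Aᵀ)ᵀ b, mulE (-Aᵀ)ᵀ (mulE (-Aᵀ)ᵀ b)] := by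
    simp only [transpose_neg, transpose_transpose, mulE_neg, mulE_apply_neg, neg_neg]
    convert hb.units_smul ![1, -1, 1] using 1
    ext i : 1
    fin_cases i <;> simp
  have hα := leadingCoeffOut_ne_zero hc hx0
  have hβ := leadingCoeffOut_ne_zero hb' hl0
  obtain ⟨δ₁, hδ₁, p₁⟩ := hx₁.exists_pos hα
  obtain ⟨δ₂, hδ₂, p₂⟩ := hx₂.exists_pos (hx ▸ hα)
  obtain ⟨δ₃, hδ₃, p₃⟩ := hl₁.exists_pos hβ
  obtain ⟨δ₄, hδ₄, p₄⟩ := hl₂.exists_pos (hl ▸ hβ)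
  rw [← hx] at p₂
  rw [← hl] at p₄
  have hu : ∀ᵐ t, t ∈ Set.Ioo 0 (min (min δ₁ δ₂) (min δ₃ δ₄)) → u₁ t = u₂ t := by
    filter_upwards [hmax₁, hmax₂] with t m₁ m₂ ht
    obtain ⟨ht0, ht⟩ := ht
    simp only [lt_min_iff] at ht
    refine control_eq_of_maximizing
      (κ := leadingCoeffOut (-Aᵀ) b (l₁ 0) * leadingCoeffOut A c (x₁ 0))
      (hx₁.2.1 t) (hx₂.2.1 t) ?_ ?_ (m₁ ht0.le) (m₂ ht0.le)
    · rw [mul_mul_mul_comm]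
      exact mul_pos (p₃ t ⟨ht0, ht.2.1⟩) (p₁ t ⟨ht0, ht.1.1⟩)
    · rw [mul_mul_mul_comm]
      exact mul_pos (p₄ t ⟨ht0, ht.2.2⟩) (p₂ t ⟨ht0, ht.1.2⟩)
  have hδ : 0 < min (min δ₁ δ₂) (min δ₃ δ₄) := by positivity
  obtain ⟨ε, hε, ex⟩ := exists_eqOn_of_control_ae_eq hx₁ hx₂ hx hδ hu
  obtain ⟨ε', hε', el⟩ := exists_eqOn_of_control_ae_eq hl₁ hl₂ hl hδ hu
  exact ⟨min ε ε', lt_min hε hε', fun t ht =>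
    ⟨ex t ⟨ht.1, ht.2.trans (min_le_left _ _)⟩, el t ⟨ht.1, ht.2.trans (min_le_right _ _)⟩⟩⟩

lemma ae_nonneg_shift {P : ℝ → Prop} (h : ∀ᵐ t ∂(volume.restrict (Set.Ici (0:ℝ))), P t)
    {T : ℝ} (hT : 0 ≤ T) : ∀ᵐ t, 0 ≤ t → P (T + t) := by
  rw [ae_restrict_iff' measurableSet_Ici] at h
  filter_upwards [(measurePreserving_add_left volume T).quasiMeasurePreserving.ae h] with t ht h0
  exact ht (add_nonneg hT h0)

theorem stmt18 (A : Matrix (Fin 3) (Fin 3) ℝ) (b c : Vec3)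
    (hdata : IsBarabanovData A b c)
    (x₀ l₀ : Vec3) (hx₀ : x₀ ≠ 0) (hl₀ : l₀ ≠ 0)
    (u₁ u₂ : ℝ → ℝ) (x₁ x₂ l₁ l₂ : ℝ → Vec3)
    (hx₁ : IsBSolWith A b c u₁ x₁) (hx₂ : IsBSolWith A b c u₂ x₂)
    (hl₁ : IsBAdjWith A b c u₁ l₁) (hl₂ : IsBAdjWith A b c u₂ l₂)
    (hx₁0 : x₁ 0 = x₀) (hx₂0 : x₂ 0 = x₀) (hl₁0 : l₁ 0 = l₀) (hl₂0 : l₂ 0 = l₀)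
    (hmax₁ : ∀ᵐ t ∂(volume.restrict (Set.Ici (0:ℝ))),
      ∀ w ∈ Set.Icc (0:ℝ) 1,
        w * (⟪b, l₁ t⟫ * ⟪c, x₁ t⟫) ≤ u₁ t * (⟪b, l₁ t⟫ * ⟪c, x₁ t⟫))
    (hmax₂ : ∀ᵐ t ∂(volume.restrict (Set.Ici (0:ℝ))),
      ∀ w ∈ Set.Icc (0:ℝ) 1,
        w * (⟪b, l₂ t⟫ * ⟪c, x₂ t⟫) ≤ u₂ t * (⟪b, l₂ t⟫ * ⟪c, x₂ t⟫)) :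
    ∀ t ≥ (0:ℝ), x₁ t = x₂ t ∧ l₁ t = l₂ t := by
  obtain ⟨-, -, hb, hc, -⟩ := hdata
  have hl₁' := hl₁.isBSolWith hx₁.1 hx₁.2.1
  have hl₂' := hl₂.isBSolWith hx₂.1 hx₂.2.1
  intro T hT
  have hclosed : IsClosed ({t | x₁ t = x₂ t ∧ l₁ t = l₂ t} ∩ Set.Icc 0 T) := by
    have hsub : Set.Icc 0 T ⊆ Set.Ici 0 := Set.Icc_subset_Ici_self
    have hcont : ContinuousOn (fun t => (x₁ t - x₂ t, l₁ t - l₂ t)) (Set.Icc 0 T) :=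
      ((hx₁.2.2.1.sub hx₂.2.2.1).prodMk (hl₁.1.sub hl₂.1)).mono hsub
    have hset : {t | x₁ t = x₂ t ∧ l₁ t = l₂ t} =
        (fun t => (x₁ t - x₂ t, l₁ t - l₂ t)) ⁻¹' {0} := by
      ext t
      simp [sub_eq_zero]
    rw [Set.inter_comm, hset]
    exact hcont.preimage_isClosed_of_isClosed isClosed_Icc isClosed_singleton
  refine hclosed.Icc_subset_of_forall_exists_gt ⟨by rw [hx₁0, hx₂0], by rw [hl₁0, hl₂0]⟩ ?_
    (Set.right_mem_Icc.2 hT)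
  rintro t ⟨⟨hxt, hlt⟩, ht⟩ y hy
  obtain ⟨ε, hε, heq⟩ := exists_eqOn_of_extremal hb hc (hx₁.shift ht.1) (hx₂.shift ht.1)
    (hl₁'.shift ht.1) (hl₂'.shift ht.1) (by simpa using hxt) (by simpa using hlt)
    (by simpa using hx₁.ne_zero (hx₁0 ▸ hx₀) ht.1) (by simpa using hl₁'.ne_zero (hl₁0 ▸ hl₀) ht.1)
    (ae_nonneg_shift hmax₁ ht.1) (ae_nonneg_shift hmax₂ ht.1)
  have hy' : 0 < y - t := sub_pos.2 hy
  refine ⟨t + min ε (y - t), heq _ ⟨by positivity, min_le_left _ _⟩,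
    lt_add_of_pos_right _ (by positivity), ?_⟩
  linarith [min_le_right ε (y - t)]
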